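/- Let m > 1 be an integer and let C be a real constant with C > (3/π)(1 − 1/m). Then there exists P such that for every prime p ≥ P with p ≡ 1 (mod m) and every real interval (a,b) ⊆ (0,p), the number of integers k with a < k < b that are m-th power residues mod p differs from (b − a)/m by at most C √p log p. -/

import Mathlib

open ZMod in
/-- The exponential sum over a set of residues. -/
noncomputable def resEta {p : ℕ} [NeZero p] (R : Finset (ZMod p)) (a : ZMod p) : ℂ :=
  ∑ r ∈ R, stdAddChar (a * r)

lemma inv_sin_le_half {y : ℝ} (h0 : 0 < y) (h1 : y ≤ Real.pi / 2) :
    1 / Real.sin y ≤ 1 / y + 1 := by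
  have hs : 0 < Real.sin y := Real.sin_pos_of_pos_of_lt_pi h0 (by linarith [Real.pi_pos])
  have key : y ≤ (1 + y) * Real.sin y := by
    rcases le_total y 1 with h | h
    · have := Real.sin_gt_sub_cube h0
      have h2 : (1 + y) * (y - y ^ 3 / 6) ≤ (1 + y) * Real.sin y := by gcongr
      have h3 : (1 + y) * (y - y ^ 3 / 6) = y + y ^ 2 * (1 - y / 6 - y ^ 2 / 6) := by ring
      have h4 : 0 ≤ y ^ 2 * (1 - y / 6 - y ^ 2 / 6) := by
        apply mul_nonneg (sq_nonneg _); nlinarith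
      linarith
    · have := Real.mul_le_sin h0.le h1
      have h2 : (1 + y) * (2 / Real.pi * y) ≤ (1 + y) * Real.sin y := by gcongr
      have h3 : 1 / 2 ≤ 2 / Real.pi := by
        rw [div_le_div_iff₀ (by norm_num) Real.pi_pos]; linarith [Real.pi_le_four]
      nlinarith [mul_le_mul_of_nonneg_right h3 (by positivity : 0 ≤ (1 + y) * y)]
  rw [div_add_one h0.ne', div_le_div_iff₀ hs h0]
  linarith

lemma inv_sin_le {x : ℝ} (h0 : 0 < x) (h1 : x < 1) :
    1 / Real.sin (Real.pi * x) ≤ 1 / (Real.pi * x) + 1 / (Real.pi * (1 - x)) + 1 := by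
  have hpi := Real.pi_pos
  have h1' : 0 < 1 - x := by linarith
  rcases le_total x (1 / 2) with h | h
  · have := inv_sin_le_half (y := Real.pi * x) (by positivity) (by nlinarith)
    have h3 : 0 ≤ 1 / (Real.pi * (1 - x)) := by positivity
    linarith
  · have := inv_sin_le_half (y := Real.pi * (1 - x)) (by positivity) (by nlinarith)
    have h3 : 0 ≤ 1 / (Real.pi * x) := by positivity
    have h4 : Real.sin (Real.pi * (1 - x)) = Real.sin (Real.pi * x) := by
      rw [mul_sub, mul_one, Real.sin_pi_sub]
    rw [h4] at this
    linarith

lemma sum_inv_sin_le {p : ℕ} (hp : 2 ≤ p) :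
    ∑ a ∈ Finset.Ico 1 p, 1 / Real.sin (Real.pi * (a / p)) ≤
      p * (2 / Real.pi * (1 + Real.log p) + 1) := by
  have hp0 : (0 : ℝ) < p := by positivity
  have hpi := Real.pi_pos
  have h1 : ∑ a ∈ Finset.Ico 1 p, 1 / Real.sin (Real.pi * (a / p)) ≤
      ∑ a ∈ Finset.Ico 1 p, (p / Real.pi * (1 / (a : ℝ)) +
        p / Real.pi * (1 / ((p - a : ℕ) : ℝ)) + 1) := by
    apply Finset.sum_le_sum
    intro a ha
    rw [Finset.mem_Ico] at ha
    have ha0 : (0 : ℝ) < a := by exact_mod_cast ha.1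
    have ha1 : (a : ℝ) < p := by exact_mod_cast ha.2
    refine (inv_sin_le (x := a / p) (by positivity) ((div_lt_one hp0).2 ha1)).trans (le_of_eq ?_)
    rw [Nat.cast_sub ha.2.le]
    have : (p : ℝ) - a ≠ 0 := by linarith
    have h5 : (1 : ℝ) - a / p = (p - a) / p := by field_simp
    rw [h5]
    field_simp
  have hH : ∑ a ∈ Finset.Ico 1 p, 1 / (a : ℝ) ≤ 1 + Real.log p := by
    have := harmonic_le_one_add_log (p - 1)
    have h2 : ((harmonic (p - 1) : ℚ) : ℝ) = ∑ a ∈ Finset.Ico 1 p, 1 / (a : ℝ) := by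
      rw [Finset.sum_Ico_eq_sum_range, harmonic]
      push_cast
      apply Finset.sum_congr rfl
      intro i _
      rw [one_div, add_comm]
    have h3 : Real.log ((p - 1 : ℕ) : ℝ) ≤ Real.log p := by
      apply Real.log_le_log
      · exact_mod_cast (by omega : 0 < p - 1)
      · exact_mod_cast Nat.sub_le _ _
    linarith
  have hH' : ∑ a ∈ Finset.Ico 1 p, 1 / ((p - a : ℕ) : ℝ) = ∑ a ∈ Finset.Ico 1 p, 1 / (a : ℝ) := by
    apply Finset.sum_nbij' (fun a => p - a) (fun a => p - a)
    · intro a ha; simp only [Finset.mem_Ico] at *; omega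
    · intro a ha; simp only [Finset.mem_Ico] at *; omega
    · intro a ha; simp only [Finset.mem_Ico] at *; omega
    · intro a ha; simp only [Finset.mem_Ico] at *; omega
    · intro a ha; rfl
  refine h1.trans ?_
  rw [Finset.sum_add_distrib, Finset.sum_add_distrib, ← Finset.mul_sum, ← Finset.mul_sum, hH']
  simp only [Finset.sum_const, Nat.card_Ico, nsmul_eq_mul, mul_one]
  have h6 : ((p - 1 : ℕ) : ℝ) ≤ p := by exact_mod_cast Nat.sub_le _ _
  have h7 := mul_le_mul_of_nonneg_left hH (by positivity : 0 ≤ p / Real.pi)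
  have h8 : p * (2 / Real.pi * (1 + Real.log p) + 1) =
    p / Real.pi * (1 + Real.log p) + p / Real.pi * (1 + Real.log p) + p := by ring
  linarith

lemma norm_std_sub_one {p : ℕ} [NeZero p] {a : ℕ} (h1 : 1 ≤ a) (h2 : a < p) :
    ‖(ZMod.stdAddChar ((a : ℕ) : ZMod p) : ℂ) - 1‖ = 2 * Real.sin (Real.pi * (a / p)) := by
  have h := ZMod.stdAddChar_coe (N := p) (a : ℤ)
  rw [Int.cast_natCast] at h
  rw [h]
  have h3 : (2 * Real.pi * Complex.I * ((a : ℤ) : ℂ) / p : ℂ)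
      = Complex.I * ((2 * Real.pi * a / p : ℝ) : ℂ) := by
    push_cast; ring
  rw [h3, Complex.norm_exp_I_mul_ofReal_sub_one]
  have h4 : 2 * Real.pi * a / p / 2 = Real.pi * (a / p) := by ring
  rw [h4, Real.norm_of_nonneg]
  have hp0 : (0 : ℝ) < p := by exact_mod_cast (by omega : 0 < p)
  have : (a : ℝ) / p ≤ 1 := (div_le_one hp0).2 (by exact_mod_cast h2.le)
  have := Real.sin_nonneg_of_nonneg_of_le_pi (x := Real.pi * (a / p)) (by positivity)
    (by nlinarith [Real.pi_pos])
  positivity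

lemma norm_interval_sum {p : ℕ} [NeZero p] {a : ℕ} (h1 : 1 ≤ a) (h2 : a < p) (s t : ℕ) :
    ‖∑ k ∈ Finset.Ico s t, (ZMod.stdAddChar (((a : ℕ) : ZMod p) * -(k : ZMod p)) : ℂ)‖
      ≤ 1 / Real.sin (Real.pi * (a / p)) := by
  have hp0 : (0 : ℝ) < p := by exact_mod_cast (by omega : 0 < p)
  have ha0 : (0 : ℝ) < a := by exact_mod_cast h1
  have ha1 : (a : ℝ) / p < 1 := (div_lt_one hp0).2 (by exact_mod_cast h2)
  have hs : 0 < Real.sin (Real.pi * (a / p)) :=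
    Real.sin_pos_of_pos_of_lt_pi (by have := Real.pi_pos; positivity) (by nlinarith [Real.pi_pos])
  set z : ℂ := ZMod.stdAddChar ((a : ℕ) : ZMod p) with hz
  have hzn : ‖z‖ = 1 := by rw [hz, ZMod.stdAddChar_apply]; exact Circle.norm_coe _
  have hz1 := norm_std_sub_one h1 h2
  rw [← hz] at hz1
  have hzne : z ≠ 1 := by
    intro h; rw [h] at hz1; simp at hz1; linarith
  have e1 : ∀ k : ℕ, (ZMod.stdAddChar (((a : ℕ) : ZMod p) * -(k : ZMod p)) : ℂ)
      = (starRingEnd ℂ) (z ^ k) := by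
    intro k
    rw [mul_neg, AddChar.map_neg_eq_conj, hz, ← AddChar.map_nsmul_eq_pow, nsmul_eq_mul, mul_comm]
  simp only [e1]
  rw [← map_sum, RCLike.norm_conj]
  rcases le_total s t with hst | hst
  · rw [geom_sum_Ico hzne hst, norm_div, hz1]
    have : ‖z ^ t - z ^ s‖ ≤ 2 := by
      refine (norm_sub_le _ _).trans ?_
      simp [hzn]; norm_num
    rw [div_le_div_iff₀ (by positivity) hs]
    nlinarith
  · rw [Finset.Ico_eq_empty (by omega)]
    simp; exact hs.le

open ZMod in
lemma sum_normSq_eta {p : ℕ} [NeZero p] (R : Finset (ZMod p)) :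
    ∑ a : ZMod p, ‖resEta R a‖ ^ 2 = p * R.card := by
  have h : (∑ a : ZMod p, ((‖resEta R a‖ ^ 2 : ℝ) : ℂ)) = p * R.card := by
    have e : ∀ a : ZMod p, ((‖resEta R a‖ ^ 2 : ℝ) : ℂ)
        = ∑ r ∈ R, ∑ s ∈ R, stdAddChar (a * (r - s)) := by
      intro a
      push_cast
      rw [← Complex.mul_conj', resEta, map_sum, Finset.sum_mul_sum]
      refine Finset.sum_congr rfl fun r _ => Finset.sum_congr rfl fun s _ => ?_
      rw [← AddChar.map_neg_eq_conj, ← AddChar.map_add_eq_mul]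
      congr 1; ring
    simp only [e]
    rw [Finset.sum_comm]
    have e2 : ∀ r ∈ R, ∑ a : ZMod p, ∑ s ∈ R, (stdAddChar (a * (r - s)) : ℂ) = p := by
      intro r hr
      rw [Finset.sum_comm]
      simp only [AddChar.sum_mulShift _ (isPrimitive_stdAddChar p), sub_eq_zero]
      simp [Finset.sum_ite_eq, hr, ZMod.card]
    rw [Finset.sum_congr rfl e2]
    simp [mul_comm]
  exact_mod_cast h

open ZMod in
lemma count_eq {p : ℕ} [NeZero p] (R : Finset (ZMod p)) (I : Finset ℕ) :
    (p : ℂ) * ((I.filter (fun k : ℕ => (k : ZMod p) ∈ R)).card : ℂ) =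
      ∑ a : ZMod p, resEta R a * ∑ k ∈ I, stdAddChar (a * -(k : ZMod p)) := by
  have e : ∀ a : ZMod p, resEta R a * ∑ k ∈ I, stdAddChar (a * -(k : ZMod p))
      = ∑ k ∈ I, ∑ r ∈ R, stdAddChar (a * (r - (k : ZMod p))) := by
    intro a
    rw [resEta, Finset.sum_mul_sum, Finset.sum_comm]
    refine Finset.sum_congr rfl fun r _ => Finset.sum_congr rfl fun s _ => ?_
    rw [← AddChar.map_add_eq_mul]
    congr 1; ring
  simp only [e]
  rw [Finset.sum_comm]
  have e2 : ∀ k ∈ I, ∑ a : ZMod p, ∑ r ∈ R, (stdAddChar (a * (r - (k : ZMod p))) : ℂ)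
      = if (k : ZMod p) ∈ R then (p : ℂ) else 0 := by
    intro r hr
    rw [Finset.sum_comm]
    simp only [AddChar.sum_mulShift _ (isPrimitive_stdAddChar p), sub_eq_zero]
    simp [Finset.sum_ite_eq', ZMod.card]
  rw [Finset.sum_congr rfl e2, ← Finset.sum_filter]
  simp [mul_comm]

open scoped Classical in
/-- The nonzero `m`-th powers mod `p`. -/
noncomputable def resSet (p m : ℕ) [NeZero p] : Finset (ZMod p) :=
  Finset.univ.filter (fun y => ∃ x : ZMod p, x ≠ 0 ∧ x ^ m = y)

lemma mem_resSet {p m : ℕ} [NeZero p] {y : ZMod p} :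
    y ∈ resSet p m ↔ ∃ x : ZMod p, x ≠ 0 ∧ x ^ m = y := by
  simp [resSet]

lemma card_resSet {p m : ℕ} [Fact p.Prime] (h : m ∣ p - 1) :
    m * (resSet p m).card = p - 1 := by
  have hc : (resSet p m).card = Nat.card (powMonoidHom m : (ZMod p)ˣ →* (ZMod p)ˣ).range := by
    have hs : (resSet p m : Set (ZMod p)) =
        Set.image Units.val ((powMonoidHom m : (ZMod p)ˣ →* (ZMod p)ˣ).range : Set (ZMod p)ˣ) := by
      ext y
      simp only [mem_resSet, Set.mem_image, SetLike.mem_coe, MonoidHom.mem_range,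
        powMonoidHom_apply]
      constructor
      · rintro ⟨x, hx, rfl⟩
        exact ⟨Units.mk0 x hx ^ m, ⟨Units.mk0 x hx, rfl⟩, by simp⟩
      · rintro ⟨_, ⟨u, rfl⟩, rfl⟩
        exact ⟨u, u.ne_zero, by simp⟩
    rw [← Set.ncard_coe_finset, hs, Set.ncard_image_of_injective _ Units.val_injective]
    rfl
  have h1 := IsCyclic.card_powMonoidHom_range (G := (ZMod p)ˣ) m
  have h2 : Nat.card (ZMod p)ˣ = p - 1 := by
    rw [Nat.card_eq_fintype_card, ZMod.card_units]
  rw [hc, h1, h2, Nat.gcd_eq_right h, Nat.mul_div_cancel' h]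

lemma eta_bound {p m : ℕ} [Fact p.Prime] (h : m ∣ p - 1) {a : ZMod p} (ha : a ≠ 0) :
    ‖resEta (resSet p m) a‖ ^ 2 ≤ p - (resSet p m).card := by
  set R := resSet p m with hR
  have hcard := card_resSet h
  have hp := (Fact.out : p.Prime).two_le
  have hRpos : 0 < R.card := by
    rcases Nat.eq_zero_or_pos R.card with h0 | h0
    · rw [← hR, h0] at hcard; omega
    · exact h0
  have inv : ∀ u ∈ R, resEta R (a * u) = resEta R a := by
    intro u hu
    obtain ⟨v, hv, hvu⟩ := mem_resSet.1 hu
    unfold resEta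
    apply Finset.sum_bij' (fun r _ => u * r) (fun r _ => u⁻¹ * r)
    · intro r hr
      obtain ⟨w, hw, hwr⟩ := mem_resSet.1 hr
      exact mem_resSet.2 ⟨v * w, mul_ne_zero hv hw, by rw [mul_pow, hvu, hwr]⟩
    · intro r hr
      obtain ⟨w, hw, hwr⟩ := mem_resSet.1 hr
      exact mem_resSet.2 ⟨v⁻¹ * w, mul_ne_zero (inv_ne_zero hv) hw,
        by rw [mul_pow, inv_pow, hvu, hwr]⟩
    · intro r _
      have : u ≠ 0 := hvu ▸ pow_ne_zero _ hv
      field_simp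
    · intro r _
      have : u ≠ 0 := hvu ▸ pow_ne_zero _ hv
      field_simp
    · intro r _
      rw [mul_assoc]
  have h1 : ∑ u ∈ R, ‖resEta R (a * u)‖ ^ 2 = R.card * ‖resEta R a‖ ^ 2 := by
    rw [Finset.sum_congr rfl (fun u hu => by rw [inv u hu])]
    simp
  have h2 : ∑ u ∈ R, ‖resEta R (a * u)‖ ^ 2 ≤ ∑ b ∈ Finset.univ.erase (0 : ZMod p),
      ‖resEta R b‖ ^ 2 := by
    rw [← Finset.sum_image (f := fun b => ‖resEta R b‖ ^ 2) (g := fun u => a * u)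
      (fun x _ y _ hxy => mul_left_cancel₀ ha hxy)]
    apply Finset.sum_le_sum_of_subset_of_nonneg
    · intro b hb
      obtain ⟨u, hu, rfl⟩ := Finset.mem_image.1 hb
      obtain ⟨v, hv, hvu⟩ := mem_resSet.1 hu
      simp [ha, ← hvu, hv]
    · intros; positivity
  have h3 := Finset.add_sum_erase Finset.univ (fun b => ‖resEta R b‖ ^ 2)
    (Finset.mem_univ (0 : ZMod p))
  have h4 : resEta R 0 = R.card := by simp [resEta]
  rw [sum_normSq_eta] at h3
  simp only [h4, Complex.norm_natCast] at h3
  have hRp : (0 : ℝ) < R.card := by exact_mod_cast hRpos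
  have : (R.card : ℝ) * ‖resEta R a‖ ^ 2 ≤ R.card * (p - R.card) := by nlinarith
  exact le_of_mul_le_mul_left this hRp

lemma main_error {p m : ℕ} [Fact p.Prime] (h : m ∣ p - 1) (s t : ℕ) :
    |((((Finset.Ico s t).filter (fun k : ℕ => (k : ZMod p) ∈ resSet p m)).card : ℕ) : ℝ)
      - (resSet p m).card * (t - s : ℕ) / p| ≤
    Real.sqrt (p - (resSet p m).card) * (2 / Real.pi * (1 + Real.log p) + 1) := by
  set R := resSet p m with hR
  have hp := (Fact.out : p.Prime).two_le
  have hp0 : (0 : ℝ) < p := by positivity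
  have hc := count_eq R (Finset.Ico s t)
  rw [← Finset.add_sum_erase _ _ (Finset.mem_univ (0 : ZMod p))] at hc
  have h4 : resEta R 0 = R.card := by simp [resEta]
  set N := ((Finset.Ico s t).filter (fun k : ℕ => (k : ZMod p) ∈ R)).card with hN
  simp only [h4, zero_mul, AddChar.map_zero_eq_one, Finset.sum_const, Nat.card_Ico, nsmul_eq_mul,
    mul_one] at hc
  set E := ∑ a ∈ Finset.univ.erase (0 : ZMod p), resEta R a *
    ∑ k ∈ Finset.Ico s t, (ZMod.stdAddChar (a * -(k : ZMod p)) : ℂ) with hE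
  have hEn : ‖E‖ ≤ Real.sqrt (p - R.card) * (p * (2 / Real.pi * (1 + Real.log p) + 1)) := by
    have h5 : ‖E‖ ≤ ∑ a ∈ Finset.univ.erase (0 : ZMod p),
        Real.sqrt (p - R.card) * (1 / Real.sin (Real.pi * ((a.val : ℝ) / p))) := by
      refine (norm_sum_le _ _).trans (Finset.sum_le_sum fun a ha => ?_)
      have ha0 : a ≠ 0 := Finset.ne_of_mem_erase ha
      rw [norm_mul]
      apply mul_le_mul _ _ (norm_nonneg _) (Real.sqrt_nonneg _)
      · exact Real.le_sqrt_of_sq_le (eta_bound h ha0)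
      · have := norm_interval_sum (p := p) (a := a.val)
          (Nat.pos_of_ne_zero ((ZMod.val_ne_zero a).2 ha0)) (ZMod.val_lt a) s t
        rwa [ZMod.natCast_zmod_val] at this
    refine h5.trans ?_
    rw [← Finset.mul_sum]
    apply mul_le_mul_of_nonneg_left _ (Real.sqrt_nonneg _)
    refine le_trans (le_of_eq ?_) (sum_inv_sin_le hp)
    apply Finset.sum_bij' (fun (a : ZMod p) _ => a.val) (fun (k : ℕ) _ => (k : ZMod p))
    · intro a ha
      have ha0 : a ≠ 0 := Finset.ne_of_mem_erase ha
      exact Finset.mem_Ico.2 ⟨Nat.pos_of_ne_zero ((ZMod.val_ne_zero a).2 ha0), ZMod.val_lt a⟩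
    · intro k hk
      rw [Finset.mem_Ico] at hk
      refine Finset.mem_erase.2 ⟨?_, Finset.mem_univ _⟩
      rw [Ne, ZMod.natCast_eq_zero_iff]
      exact Nat.not_dvd_of_pos_of_lt hk.1 hk.2
    · intro a _; exact ZMod.natCast_zmod_val a
    · intro k hk
      rw [Finset.mem_Ico] at hk
      exact ZMod.val_cast_of_lt hk.2
    · intro a _; rfl
  have h6 : ((p * (N - R.card * (t - s : ℕ) / p : ℝ) : ℝ) : ℂ) = E := by
    have : (p : ℂ) ≠ 0 := by exact_mod_cast hp0.ne'
    rw [← sub_eq_iff_eq_add'] at hc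
    rw [← hc]
    push_cast
    field_simp
  rw [← h6, Complex.norm_real, norm_mul, Real.norm_of_nonneg hp0.le, Real.norm_eq_abs,
    mul_left_comm] at hEn
  exact le_of_mul_le_mul_left hEn hp0

set_option maxHeartbeats 1000000 in
open scoped Classical in
/-- Let `m > 1` and `C > (3/π)(1 − 1/m)`. For all sufficiently large primes `p ≡ 1 (mod m)`
and every interval `(a, b) ⊆ (0, p)`, the number of `m`-th power residues mod `p` in `(a, b)`
is within `C √p log p` of `(b − a)/m`. -/
theorem residues_equidistributed (m : ℕ) (hm : 1 < m) (C : ℝ)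
    (hC : (3 / Real.pi) * (1 - 1 / m) < C) :
    ∃ P : ℕ, ∀ p : ℕ, p.Prime → P ≤ p → p % m = 1 →
      ∀ a b : ℝ, 0 ≤ a → a ≤ b → b ≤ p →
        |(((Finset.Icc 1 (p - 1)).filter (fun k : ℕ =>
              a < (k : ℝ) ∧ (k : ℝ) < b ∧
              ∃ x : ZMod p, x ≠ 0 ∧ x ^ m = ((k : ℕ) : ZMod p))).card : ℝ)
            - (b - a) / m|
          ≤ C * Real.sqrt p * Real.log p := by
  have hm0 : (0 : ℝ) < m := by positivity
  have hm2 : (2 : ℝ) ≤ m := by exact_mod_cast hm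
  set c : ℝ := 1 - 1 / m with hc
  have him : (1 : ℝ) / m ≤ 1 / 2 := by
    rw [div_le_div_iff₀ hm0 (by norm_num)]; linarith
  have him0 : (0 : ℝ) < 1 / m := by positivity
  have hc1 : 1 / 2 ≤ c := by rw [hc]; linarith
  have hc2 : c ≤ 1 := by rw [hc]; linarith
  set d := C - 3 / Real.pi * c with hd
  have hd0 : 0 < d := by rw [hd]; linarith
  refine ⟨⌈Real.exp (10 / d)⌉₊, ?_⟩
  intro p hp hP hpm a b ha hab hb
  have : Fact p.Prime := ⟨hp⟩
  have hp2 := hp.two_le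
  have hp0 : (0 : ℝ) < p := by positivity
  have hdvd : m ∣ p - 1 := (Nat.modEq_iff_dvd' hp.one_le).1
    (by rw [Nat.ModEq, hpm, Nat.mod_eq_of_lt hm])
  have hL : 10 ≤ d * Real.log p := by
    have h1 : Real.exp (10 / d) ≤ p := (Nat.le_ceil _).trans (by exact_mod_cast hP)
    have h2 := (Real.le_log_iff_exp_le hp0).2 h1
    rw [div_le_iff₀ hd0] at h2
    linarith
  set L := Real.log p with hLdef
  set q := Real.sqrt p with hq
  have hqq : q ^ 2 = p := Real.sq_sqrt hp0.le
  have hq1 : 1 ≤ q := by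
    rw [hq, Real.one_le_sqrt]; exact_mod_cast hp.one_le
  have hL0 : 0 ≤ L := Real.log_nonneg (by exact_mod_cast hp.one_le)
  have hLq : L ≤ 2 * q := by
    have h1 : L = 2 * Real.log q := by
      rw [hLdef, ← hqq, Real.log_pow]; norm_num
    have := Real.log_le_sub_one_of_pos (by linarith : 0 < q)
    linarith
  set s := ⌊a⌋₊ + 1 with hs
  set t := ⌈b⌉₊ with ht
  have htp : t ≤ p := Nat.ceil_le.2 hb
  have hset : ∀ inst : DecidablePred (fun k : ℕ =>
      a < (k : ℝ) ∧ (k : ℝ) < b ∧ ∃ x : ZMod p, x ≠ 0 ∧ x ^ m = ((k : ℕ) : ZMod p)),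
      @Finset.filter ℕ _ inst (Finset.Icc 1 (p - 1)) =
      (Finset.Ico s t).filter (fun k : ℕ => (k : ZMod p) ∈ resSet p m) := by
    intro inst
    ext k
    simp only [Finset.mem_filter, Finset.mem_Icc, Finset.mem_Ico, mem_resSet]
    rw [← Nat.floor_lt ha, ← Nat.lt_ceil]
    constructor
    · rintro ⟨_, h1, h2, h3⟩
      exact ⟨⟨by omega, h2⟩, h3⟩
    · rintro ⟨⟨h1, h2⟩, h3⟩
      exact ⟨⟨by omega, by omega⟩, by omega, h2, h3⟩
  rw [hset]
  have hmain := main_error hdvd s t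
  set N := ((Finset.Ico s t).filter (fun k : ℕ => (k : ZMod p) ∈ resSet p m)).card with hN
  set R := (resSet p m).card with hR
  have hRc : (m : ℝ) * R = p - 1 := by
    have := card_resSet hdvd
    rw [← Nat.cast_one, ← Nat.cast_sub hp.one_le, ← this]
    push_cast; rfl
  have hRe : (R : ℝ) = (p - 1) * (1 / m) := by
    field_simp; linarith
  set n := t - s with hn
  have hnb : |(n : ℝ) - (b - a)| ≤ 1 := by
    have f1 := Nat.floor_le ha
    have f2 := Nat.lt_floor_add_one a
    have f3 := Nat.le_ceil b
    have f4 := Nat.ceil_lt_add_one (ha.trans hab)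
    rw [abs_le]
    rcases le_total s t with h | h
    · rw [hn, Nat.cast_sub h, hs, ht]
      push_cast
      constructor <;> linarith
    · have h0 : n = 0 := by omega
      have h5 : (t : ℝ) ≤ ⌊a⌋₊ + 1 := by exact_mod_cast h
      rw [h0]
      push_cast
      constructor <;> linarith
  have hnp : (n : ℝ) ≤ p := by exact_mod_cast (by omega : n ≤ p)
  have hn0 : (0 : ℝ) ≤ n := by positivity
  have hrest : |(R : ℝ) * n / p - (b - a) / m| ≤ 2 := by
    have e : (R : ℝ) * n / p - (b - a) / m = 1 / m * ((n - (b - a)) - n / p) := by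
      rw [hRe]; field_simp; ring
    rw [e, abs_mul, abs_of_pos him0]
    have h1 : (n : ℝ) / p ≤ 1 := (div_le_one hp0).2 hnp
    have h2 : 0 ≤ (n : ℝ) / p := by positivity
    have h3 : |(n - (b - a)) - (n : ℝ) / p| ≤ 2 := by
      rw [abs_le] at hnb ⊢
      constructor <;> linarith [hnb.1, hnb.2]
    nlinarith [abs_nonneg ((n - (b - a)) - (n : ℝ) / p)]
  have hsq : Real.sqrt (p - R) ≤ 3 / 2 * c * q + 1 := by
    apply Real.sqrt_le_iff.2
    refine ⟨by positivity, ?_⟩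
    have e : (p : ℝ) - R = c * p + 1 / m := by rw [hRe, hc]; ring
    rw [e, ← hqq]
    have h1 : 0 ≤ c * q := by positivity
    have h2 : c * q ^ 2 ≤ 9 / 4 * c ^ 2 * q ^ 2 := by
      apply mul_le_mul_of_nonneg_right _ (sq_nonneg _)
      nlinarith
    nlinarith
  have hpi : 2 / Real.pi ≤ 1 := by
    rw [div_le_one Real.pi_pos]; linarith [Real.pi_gt_three]
  have hpi0 : 0 ≤ 2 / Real.pi := by have := Real.pi_pos; positivity
  have hX : 2 / Real.pi * (1 + L) + 1 ≤ 2 / Real.pi * L + 2 := by linarith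
  have hprod : Real.sqrt (p - R) * (2 / Real.pi * (1 + L) + 1) ≤
      (3 / 2 * c * q + 1) * (2 / Real.pi * L + 2) :=
    mul_le_mul hsq hX (by positivity) (by positivity)
  have hexp : (3 / 2 * c * q + 1) * (2 / Real.pi * L + 2) =
      3 / Real.pi * c * q * L + 3 * (c * q) + 2 / Real.pi * L + 2 := by ring
  have hcq : c * q ≤ q := mul_le_of_le_one_left (by linarith) hc2
  have hpL : 2 / Real.pi * L ≤ L := mul_le_of_le_one_left hL0 hpi
  have hfin : C * q * L = 3 / Real.pi * c * q * L + q * (d * L) := by rw [hd]; ring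
  have hqd : q * 10 ≤ q * (d * L) := mul_le_mul_of_nonneg_left hL (by linarith)
  have htri := abs_sub_le (N : ℝ) ((R : ℝ) * n / p) ((b - a) / m)
  linarith
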